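/- If x₁,…,x_i are independent standard Gaussian random vectors in ℝ^d (with 1 ≤ i ≤ d) and β < d - i + 1, then the expectation E(‖x₁ ∧ ⋯ ∧ x_i‖^{-β}) is finite. -/

import Mathlib

open MeasureTheory ProbabilityTheory

/-- The standard Gaussian measure on `ℝ^d` (i.i.d. `N(0,1)` coordinates). -/
noncomputable def stdGaussian (d : ℕ) : Measure (Fin d → ℝ) :=
  Measure.pi fun _ => gaussianReal 0 1

/-- The norm of the wedge product `x₁ ∧ ⋯ ∧ x_i` in `⋀^i ℝ^d`, i.e. the `i`-dimensional
volume of the parallelepiped spanned by `x₁, …, x_i`, computed as the square root of the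
Gram determinant. -/
noncomputable def wedgeNorm {d : ℕ} {i : ℕ} (x : Fin i → (Fin d → ℝ)) : ℝ :=
  Real.sqrt (Matrix.det (Matrix.of fun a b : Fin i => ∑ j, x a j * x b j))

lemma lintegral_enorm_rpow_gaussianReal_lt_top {s : ℝ} (hs : -1 < s) :
    ∫⁻ x, ‖x‖ₑ ^ s ∂(gaussianReal 0 1) < ⊤ := by
  have hI : Integrable (fun x : ℝ => ‖x‖ ^ s * Real.exp (-(1 / 2) * ‖x‖ ^ 2)) := by
    refine (integrable_fun_norm_addHaar volume
      (f := fun r : ℝ => r ^ s * Real.exp (-(1 / 2) * r ^ 2))).2 ?_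
    simpa using integrableOn_rpow_mul_exp_neg_mul_sq (b := 1 / 2) (by norm_num) hs
  have hfin := (hI.const_mul (√(2 * Real.pi))⁻¹).lintegral_lt_top
  rw [gaussianReal_of_var_ne_zero _ one_ne_zero, lintegral_withDensity_eq_lintegral_mul _
    (measurable_gaussianPDF 0 1) (by fun_prop)]
  refine lt_of_eq_of_lt (lintegral_congr_ae ?_) hfin
  filter_upwards [Measure.ae_ne volume (0 : ℝ)] with x hx
  have : 0 < ‖x‖ := norm_pos_iff.2 hx
  simp only [Pi.mul_apply]
  rw [gaussianPDF, ← ofReal_norm, ENNReal.ofReal_rpow_of_pos this,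
    ← ENNReal.ofReal_mul (gaussianPDFReal_nonneg _ _ _), gaussianPDFReal]
  congr 1
  have h2 : -(x - 0) ^ 2 / (2 * ((1 : NNReal) : ℝ)) = -(1 / 2) * ‖x‖ ^ 2 := by
    rw [Real.norm_eq_abs, sq_abs]; push_cast; ring
  rw [h2]
  simp
  ring

section InnerProductSpace

variable {E : Type*} [NormedAddCommGroup E] [InnerProductSpace ℝ E] [FiniteDimensional ℝ E]

lemma exists_orthonormalBasis_finset_mem {m : ℕ} (T : Submodule ℝ E)
    (hT : m ≤ Module.finrank ℝ T) :
    ∃ (u : Finset E) (b : OrthonormalBasis u ℝ E) (J : Finset u), J.card = m ∧ ∀ j ∈ J, b j ∈ T := by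
  have ho := (stdOrthonormalBasis ℝ T).orthonormal.comp_linearIsometry T.subtypeₗᵢ
  obtain ⟨u, b, hu, hb⟩ := ho.toSubtypeRange.exists_orthonormalBasis_extension
  have hmem : ∀ i, T.subtypeₗᵢ (stdOrthonormalBasis ℝ T i) ∈ u := fun i => hu ⟨i, rfl⟩
  let f : Fin (Module.finrank ℝ T) ↪ u := ⟨fun i => ⟨_, hmem i⟩, fun i j h => by
    have hval : (stdOrthonormalBasis ℝ T i : E) = stdOrthonormalBasis ℝ T j :=
      congrArg (fun z : u => (z : E)) h
    exact (stdOrthonormalBasis ℝ T).orthonormal.linearIndependent.injective (Subtype.ext hval)⟩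
  obtain ⟨J, hJ, hcard⟩ := Finset.exists_subset_card_eq
    (s := Finset.univ.map f) (n := m) (by simpa using hT)
  refine ⟨u, b, J, hcard, fun j hj => ?_⟩
  obtain ⟨i, -, rfl⟩ := Finset.mem_map.1 (hJ hj)
  rw [hb]
  exact (stdOrthonormalBasis ℝ T i).2

lemma det_gram_succ {k : ℕ} (v : Fin (k + 1) → E) :
    (Matrix.gram ℝ v).det =
      ‖(Submodule.span ℝ (Set.range fun a : Fin k => v a.succ))ᗮ.starProjection (v 0)‖ ^ 2 *
        (Matrix.gram ℝ fun a : Fin k => v a.succ).det := by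
  set S := Submodule.span ℝ (Set.range fun a : Fin k => v a.succ)
  set q := Sᗮ.starProjection (v 0) with hq
  have hqS : q ∈ Sᗮ := Submodule.starProjection_apply_mem _ _
  have hp : v 0 - q ∈ S := by
    rw [hq, Submodule.starProjection_orthogonal_val, sub_sub_cancel]
    exact Submodule.starProjection_apply_mem _ _
  obtain ⟨c, hc⟩ := (Submodule.mem_span_range_iff_exists_fun ℝ).1 hp
  have hqv : ∀ a : Fin k, inner ℝ q (v a.succ) = 0 := fun a =>
    Submodule.inner_left_of_mem_orthogonal (Submodule.subset_span (Set.mem_range_self a)) hqS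
  have hq0 : inner ℝ q (v 0) = ‖q‖ ^ 2 := by
    rw [← real_inner_self_eq_norm_sq, ← sub_eq_zero, ← inner_sub_right]
    exact Submodule.inner_left_of_mem_orthogonal hp hqS
  let c' : Fin (k + 1) → ℝ := Fin.cons 1 fun a => -c a
  have hrow : ∑ a, c' a • Matrix.gram ℝ v a = fun b => inner ℝ q (v b) := by
    have hsum : q = ∑ a, c' a • v a := by
      rw [Fin.sum_univ_succ]
      simp [c', hc]
    ext b
    simp [hsum, Matrix.gram_apply, sum_inner, inner_smul_left]
  have hdet := Matrix.det_updateRow_sum (Matrix.gram ℝ v) 0 c'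
  rw [hrow] at hdet
  have hc0 : c' 0 = 1 := rfl
  rw [hc0, one_smul] at hdet
  rw [← hdet, Matrix.det_succ_row_zero, Fin.sum_univ_succ]
  simp only [Matrix.updateRow_self, hqv, hq0]
  have hsub : ((Matrix.gram ℝ v).updateRow 0 fun b => inner ℝ q (v b)).submatrix Fin.succ Fin.succ =
      Matrix.gram ℝ fun a : Fin k => v a.succ := by
    ext a b
    simp [Matrix.gram_apply]
  simp [hsub]

variable [MeasurableSpace E] [BorelSpace E]

lemma exists_lintegral_enorm_starProjection_rpow_le {m : ℕ} (hm : 0 < m) {β : ℝ} (hβ : β < m) :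
    ∃ C : ENNReal, C < ⊤ ∧ ∀ T : Submodule ℝ E, m ≤ Module.finrank ℝ T →
      ∫⁻ y, ‖T.starProjection y‖ₑ ^ (-β) ∂(ProbabilityTheory.stdGaussian E) ≤ C := by
  rcases le_or_gt β 0 with hβ0 | hβ0
  · refine ⟨∫⁻ y, ‖y‖ₑ ^ (-β) ∂(ProbabilityTheory.stdGaussian E), ?_, fun T _ => ?_⟩
    · rcases hβ0.eq_or_lt with rfl | hneg
      · simp
      · have h := (IsGaussian.memLp_id (ProbabilityTheory.stdGaussian E)
          (ENNReal.ofReal (-β)) ENNReal.ofReal_ne_top).2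
        rw [eLpNorm_lt_top_iff_lintegral_rpow_enorm_lt_top (by simpa using hneg)
          ENNReal.ofReal_ne_top, ENNReal.toReal_ofReal (by linarith)] at h
        exact h
    · refine lintegral_mono fun y => ENNReal.rpow_le_rpow ?_ (by linarith)
      exact enorm_le_iff_norm_le.2 (T.norm_starProjection_apply_le y)
  · have hm' : (0 : ℝ) < m := by exact_mod_cast hm
    refine ⟨(∫⁻ x, ‖x‖ₑ ^ (-(β / m)) ∂(gaussianReal 0 1)) ^ m, ENNReal.pow_lt_top ?_,
      fun T hT => ?_⟩
    · refine lintegral_enorm_rpow_gaussianReal_lt_top ?_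
      have : β / m < 1 := by rwa [div_lt_one hm']
      linarith
    · obtain ⟨u, b, J, rfl, hJ⟩ := exists_orthonormalBasis_finset_mem T hT
      have hmeas : Measurable fun x : ℝ => ‖x‖ₑ ^ (-(β / (J.card : ℝ))) := by fun_prop
      calc ∫⁻ y, ‖T.starProjection y‖ₑ ^ (-β) ∂(ProbabilityTheory.stdGaussian E)
          = ∫⁻ z : u → ℝ, ‖T.starProjection (∑ i, z i • b i)‖ₑ ^ (-β)
              ∂(Measure.pi fun _ => gaussianReal 0 1) := by
            rw [stdGaussian_eq_map_pi_orthonormalBasis b,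
              lintegral_map (by fun_prop) (by fun_prop)]
        _ ≤ ∫⁻ z : u → ℝ, ∏ j ∈ J, ‖z j‖ₑ ^ (-(β / (J.card : ℝ)))
              ∂(Measure.pi fun _ => gaussianReal 0 1) := by
            refine lintegral_mono fun z => ?_
            have hexp : -β = -(β / (J.card : ℝ)) * (J.card : ℝ) := by field_simp
            dsimp only
            rw [hexp, ENNReal.rpow_mul, ENNReal.rpow_natCast, ← Finset.prod_const]
            refine Finset.prod_le_prod' fun j hj => ?_
            rw [ENNReal.rpow_neg, ENNReal.rpow_neg, ENNReal.inv_le_inv]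
            refine ENNReal.rpow_le_rpow ?_ (by positivity)
            refine enorm_le_iff_norm_le.2 ?_
            have hcoord : inner ℝ (b j) (T.starProjection (∑ i, z i • b i)) = z j := by
              rw [← T.inner_starProjection_left_eq_right,
                Submodule.starProjection_eq_self_iff.2 (hJ j hj)]
              exact b.orthonormal.inner_right_fintype z j
            rw [← hcoord]
            simpa using norm_inner_le_norm (𝕜 := ℝ) (b j) (T.starProjection (∑ i, z i • b i))
        _ = (∫⁻ x, ‖x‖ₑ ^ (-(β / (J.card : ℝ))) ∂(gaussianReal 0 1)) ^ J.card := by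
            rw [lintegral_prod_eq_prod_lintegral_of_indepFun J
              (fun j (z : u → ℝ) => ‖z j‖ₑ ^ (-(β / (J.card : ℝ))))
              (iIndepFun_pi fun _ => hmeas.aemeasurable) (fun j => by fun_prop),
              ← Finset.prod_const]
            refine Finset.prod_congr rfl fun j _ => ?_
            exact (measurePreserving_eval (fun _ : u => gaussianReal 0 1) j).lintegral_comp hmeas

end InnerProductSpace

lemma wedgeNorm_eq_sqrt_det_gram {d k : ℕ} (x : Fin k → Fin d → ℝ) :
    wedgeNorm x = √(Matrix.gram ℝ fun a => WithLp.toLp 2 (x a)).det := by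
  rw [wedgeNorm]
  congr 2
  ext a b
  simp [Matrix.gram_apply, PiLp.inner_apply, mul_comm]

lemma wedgeNorm_cons {d k : ℕ} (y : Fin d → ℝ) (x : Fin k → Fin d → ℝ) :
    wedgeNorm (Fin.cons y x : Fin (k + 1) → Fin d → ℝ) =
      ‖(Submodule.span ℝ (Set.range fun a => WithLp.toLp 2 (x a)) :
        Submodule ℝ (EuclideanSpace ℝ (Fin d)))ᗮ.starProjection (WithLp.toLp 2 y)‖ * wedgeNorm x := by
  rw [wedgeNorm_eq_sqrt_det_gram, wedgeNorm_eq_sqrt_det_gram, det_gram_succ,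
    Real.sqrt_mul (sq_nonneg _), Real.sqrt_sq (norm_nonneg _)]
  rfl

lemma measurable_wedgeNorm {d k : ℕ} :
    Measurable (wedgeNorm : (Fin k → Fin d → ℝ) → ℝ) := by
  refine Continuous.measurable (Real.continuous_sqrt.comp (Continuous.matrix_det ?_))
  exact continuous_matrix fun a b => by simp only [Matrix.of_apply]; fun_prop

instance isProbabilityMeasure_stdGaussian_pi (d : ℕ) :
    IsProbabilityMeasure (_root_.stdGaussian d) := by
  unfold _root_.stdGaussian; infer_instance

lemma lintegral_enorm_wedgeNorm_rpow_lt_top {d k : ℕ} (hk : k ≤ d) {β : ℝ}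
    (hβ : β < d - k + 1) :
    ∫⁻ x : Fin k → Fin d → ℝ, ‖wedgeNorm x‖ₑ ^ (-β)
      ∂(Measure.pi fun _ : Fin k => _root_.stdGaussian d) < ⊤ := by
  induction k with
  | zero => simp [wedgeNorm]
  | succ k ih =>
    have hβ' : β < (d - k : ℕ) := by
      rw [Nat.cast_sub (by omega)]; push_cast at hβ; linarith
    have ih := ih (by omega) (by push_cast at hβ; linarith)
    obtain ⟨C, hC, hle⟩ := exists_lintegral_enorm_starProjection_rpow_le
      (E := EuclideanSpace ℝ (Fin d)) (m := d - k) (by omega) hβ'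
    have hmeas : Measurable fun x : Fin (k + 1) → Fin d → ℝ => ‖wedgeNorm x‖ₑ ^ (-β) :=
      measurable_wedgeNorm.enorm.pow_const _
    have hmp := (measurePreserving_piFinSuccAbove
      (fun _ : Fin (k + 1) => _root_.stdGaussian d) 0).symm
    have hmeas' := hmeas.comp hmp.measurable
    rw [← hmp.lintegral_comp hmeas, lintegral_prod_symm' _ (by exact hmeas')]
    calc _ ≤ ∫⁻ x : Fin k → Fin d → ℝ, C * ‖wedgeNorm x‖ₑ ^ (-β)
          ∂(Measure.pi fun _ : Fin k => _root_.stdGaussian d) := by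
          refine lintegral_mono fun x => ?_
          set S : Submodule ℝ (EuclideanSpace ℝ (Fin d)) :=
            Submodule.span ℝ (Set.range fun a => WithLp.toLp 2 (x a))
          have hcons : ∀ y : Fin d → ℝ,
              ‖wedgeNorm ((MeasurableEquiv.piFinSuccAbove (fun _ : Fin (k + 1) => Fin d → ℝ)
                0).symm (y, x))‖ₑ ^ (-β) =
              ‖Sᗮ.starProjection (WithLp.toLp 2 y)‖ₑ ^ (-β) * ‖wedgeNorm x‖ₑ ^ (-β) := by
            intro y
            rw [← ENNReal.mul_rpow_of_ne_top (by simp) (by simp), ← enorm_norm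
              (Sᗮ.starProjection _), ← enorm_mul, ← wedgeNorm_cons]
            simp [MeasurableEquiv.piFinSuccAbove, Fin.consEquiv]
          simp only [hcons]
          have hmap : ∫⁻ y, ‖Sᗮ.starProjection (WithLp.toLp 2 y)‖ₑ ^ (-β) ∂(_root_.stdGaussian d) =
              ∫⁻ y, ‖Sᗮ.starProjection y‖ₑ ^ (-β)
                ∂(ProbabilityTheory.stdGaussian (EuclideanSpace ℝ (Fin d))) := by
            rw [← map_pi_eq_stdGaussian, lintegral_map (by fun_prop) (by fun_prop)]
            rfl
          rw [lintegral_mul_const _ (by fun_prop), hmap]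
          refine mul_le_mul_left (hle _ ?_) _
          have h1 := S.finrank_add_finrank_orthogonal
          have h2 : Module.finrank ℝ S ≤ k :=
            (finrank_range_le_card (R := ℝ) (M := EuclideanSpace ℝ (Fin d))
              fun a => WithLp.toLp 2 (x a)).trans_eq (Fintype.card_fin k)
          rw [finrank_euclideanSpace_fin] at h1
          omega
      _ < ⊤ := by
          rw [lintegral_const_mul _ (measurable_wedgeNorm.enorm.pow_const _)]
          exact ENNReal.mul_lt_top hC ih

lemma ofReal_rpow_le_enorm_rpow {x : ℝ} (hx : 0 ≤ x) (p : ℝ) :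
    ENNReal.ofReal (x ^ p) ≤ ‖x‖ₑ ^ p := by
  rcases hx.eq_or_lt with rfl | hx
  · rcases eq_or_ne p 0 with rfl | hp
    · simp
    · simp [Real.zero_rpow hp]
  · rw [← ENNReal.ofReal_rpow_of_pos hx, Real.enorm_of_nonneg hx.le]

/-- If `x₁, …, x_i` are independent standard Gaussian random vectors in `ℝ^d`
(`1 ≤ i ≤ d`) and `β < d - i + 1`, then `E(‖x₁ ∧ ⋯ ∧ x_i‖^{-β}) < ∞`. -/
theorem expectation_wedgeNorm_neg_rpow_lt_top
    (d i : ℕ) (hi : 1 ≤ i) (hid : i ≤ d) (β : ℝ) (hβ : β < d - i + 1) :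
    ∫⁻ x : Fin i → (Fin d → ℝ), ENNReal.ofReal (wedgeNorm x ^ (-β))
      ∂(Measure.pi fun _ : Fin i => stdGaussian d) < ⊤ := by
  refine (lintegral_mono fun x => ?_).trans_lt (lintegral_enorm_wedgeNorm_rpow_lt_top hid hβ)
  exact ofReal_rpow_le_enorm_rpow (Real.sqrt_nonneg _) _
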